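/- arXiv:1112.2329 — 5 statements merged into one kernel-verified Lean document; each statement's English description precedes it below -/
import Mathlib

section
/- Let A be the direct sum operator of the family (T n). Then τ ∈ ℂ belongs to the resolvent set of A (i.e. A - τ·id is boundedly invertible on lp H 2) if and only if for every n ∈ ℕ the operator T n - τ·id is boundedly invertible on H n and there exists a constant M such that ‖(T n - τ·id)⁻¹‖ ≤ M for all n ∈ ℕ. In other words ρ(A) = {τ ∈ ⋂_n ρ(A_n) : sup_n ‖R_τ(A_n)‖ < ∞}. (Corollary 2.5, fourth formula; Theorem 2.3(4) in the countable direct-sum case.) -/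
open scoped ENNReal in
/-- The diagonal blocks of an invertible block-diagonal operator `D` on `lp E p` are invertible,
and their inverses are bounded in norm by that of `D`. -/
theorem lp.isUnit_and_norm_inverse_le_of_isUnit_diagonal {ι 𝕜 : Type*} {E : ι → Type*}
    [NontriviallyNormedField 𝕜] [∀ i, NormedAddCommGroup (E i)] [∀ i, NormedSpace 𝕜 (E i)]
    {p : ℝ≥0∞} [Fact (1 ≤ p)] {S : ∀ i, E i →L[𝕜] E i} {D : lp E p →L[𝕜] lp E p}
    (hD : ∀ f i, D f i = S i (f i)) (hU : IsUnit D) (i : ι) :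
    IsUnit (S i) ∧ ‖Ring.inverse (S i)‖ ≤ ‖Ring.inverse D‖ := by
  classical
  have hp : 0 < p := zero_lt_one.trans_le Fact.out
  set B := Ring.inverse D
  have hDB (f : lp E p) : D (B f) = f := congr($(Ring.mul_inverse_cancel D hU) f)
  have hBD (f : lp E p) : B (D f) = f := congr($(Ring.inverse_mul_cancel D hU) f)
  have hsingle (x : E i) : D (lp.single p i x) = lp.single p i (S i x) := by
    ext j
    rw [hD]
    obtain rfl | hij := eq_or_ne j i
    · simp
    · simp [hij]
  let R : E i →L[𝕜] E i :=
    (lp.evalCLM 𝕜 E p i).comp (B.comp (lp.singleContinuousLinearMap 𝕜 E p i))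
  have hR (x : E i) : R x = B (lp.single p i x) i := rfl
  have hSR : S i * R = 1 := by
    ext x
    simp [hR, ← hD, hDB]
  have hRS : R * S i = 1 := by
    ext x
    simp [hR, ← hsingle, hBD]
  let u : (E i →L[𝕜] E i)ˣ := ⟨S i, R, hSR, hRS⟩
  have hinv : Ring.inverse (S i) = R := Ring.inverse_unit u
  refine ⟨u.isUnit, hinv ▸ R.opNorm_le_bound (norm_nonneg _) fun x ↦ ?_⟩
  calc ‖R x‖ ≤ ‖B (lp.single p i x)‖ := lp.norm_apply_le_norm hp.ne' _ _
    _ ≤ ‖B‖ * ‖lp.single p i x‖ := B.le_opNorm _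
    _ = ‖B‖ * ‖x‖ := by rw [lp.norm_single hp]

open scoped ENNReal in
/-- A block-diagonal operator on `lp E p` is invertible if and only if its blocks are invertible
with uniformly bounded inverses. -/
theorem lp.isUnit_diagonal_iff {ι 𝕜 : Type*} {E : ι → Type*}
    [NontriviallyNormedField 𝕜] [∀ i, NormedAddCommGroup (E i)] [∀ i, NormedSpace 𝕜 (E i)]
    {p : ℝ≥0∞} [Fact (1 ≤ p)] {S : ∀ i, E i →L[𝕜] E i} {D : lp E p →L[𝕜] lp E p}
    (hD : ∀ f i, D f i = S i (f i)) :
    IsUnit D ↔ (∀ i, IsUnit (S i)) ∧ ∃ M : ℝ, ∀ i, ‖Ring.inverse (S i)‖ ≤ M := by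
  refine ⟨fun hU ↦ ?_, fun ⟨hS, M, hM⟩ ↦ ?_⟩
  · have h := lp.isUnit_and_norm_inverse_le_of_isUnit_diagonal hD hU
    exact ⟨fun i ↦ (h i).1, _, fun i ↦ (h i).2⟩
  · let B : lp E p →L[𝕜] lp E p := lp.mapCLM p (fun i ↦ Ring.inverse (S i))
      (le_max_right M 0) fun i ↦ (hM i).trans (le_max_left M 0)
    have hB (f : lp E p) (i : ι) : B f i = Ring.inverse (S i) (f i) := rfl
    refine ⟨⟨D, B, ?_, ?_⟩, rfl⟩
    · ext f i
      exact (hD _ _).trans congr($(Ring.mul_inverse_cancel _ (hS i)) (f i))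
    · ext f i
      change B (D f) i = f i
      rw [hB, hD]
      exact congr($(Ring.inverse_mul_cancel _ (hS i)) (f i))


/-- Corollary 2.5 (fourth formula) / Theorem 2.3(4) in the countable direct-sum case:
`τ` belongs to the resolvent set of the direct sum operator `A = ⊕ₙ Tₙ`
(i.e. `A - τ·id` is boundedly invertible) if and only if each `T n - τ·id` is boundedly
invertible and the norms of the inverses are uniformly bounded; i.e.
`ρ(A) = {τ ∈ ⋂ₙ ρ(Aₙ) : supₙ ‖R_τ(Aₙ)‖ < ∞}`. -/
theorem resolventSet_of_direct_sum
    (H : ℕ → Type) [∀ n, NormedAddCommGroup (H n)]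
    [∀ n, InnerProductSpace ℂ (H n)] [∀ n, CompleteSpace (H n)]
    (T : ∀ n, H n →L[ℂ] H n) (hT : ∃ C : ℝ, ∀ n, ‖T n‖ ≤ C)
    (A : lp H 2 →L[ℂ] lp H 2)
    (hA : ∀ f : lp H 2, ∀ n : ℕ, (A f : ∀ n, H n) n = T n (f n))
    (τ : ℂ) :
    IsUnit (A - τ • (1 : lp H 2 →L[ℂ] lp H 2)) ↔
      ((∀ n : ℕ, IsUnit (T n - τ • (1 : H n →L[ℂ] H n))) ∧
        ∃ M : ℝ, ∀ n : ℕ, ‖Ring.inverse (T n - τ • (1 : H n →L[ℂ] H n))‖ ≤ M) := by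
  refine lp.isUnit_diagonal_iff fun f n ↦ ?_
  exact congr($(hA f n) - τ • f n)
end

section
/- Let A be the direct sum operator of the family (T n). Then τ ∈ ℂ belongs to the residual spectrum of A (i.e. A - τ·id is injective and its range is not dense in lp H 2) if and only if τ is not an eigenvalue of any T n and there exists n ∈ ℕ such that τ belongs to the residual spectrum of T n (i.e. T n - τ·id is injective and its range is not dense in H n). In other words σ_r(A) = (⋃_n σ_p(A_n))^c ∩ (⋃_n σ_r(A_n)). (Corollary 2.4, second formula, in the countable direct-sum case.) -/
section DiagonalOperators

variable {𝕜 ι : Type*} {E : ι → Type*} [NontriviallyNormedField 𝕜]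
  [∀ i, NormedAddCommGroup (E i)] [∀ i, NormedSpace 𝕜 (E i)] {p : ENNReal} [Fact (1 ≤ p)]
  {S : ∀ i, E i →L[𝕜] E i} {B : lp E p →L[𝕜] lp E p}

/-- A diagonal operator acts on a vector supported at one index through that component. -/
theorem lp.diagonal_apply_single [DecidableEq ι]
    (hB : ∀ (f : lp E p) (i : ι), (B f : ∀ i, E i) i = S i (f i)) (i : ι) (x : E i) :
    B (lp.single p i x) = lp.single p i (S i x) := by
  ext j
  rw [hB]
  obtain rfl | hij := eq_or_ne j i
  · simp only [lp.single_apply_self]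
  · simp only [lp.single_apply_ne _ _ _ hij, map_zero]

/-- A diagonal operator is injective iff all of its components are. -/
theorem lp.injective_diagonal_iff
    (hB : ∀ (f : lp E p) (i : ι), (B f : ∀ i, E i) i = S i (f i)) :
    Function.Injective B ↔ ∀ i, Function.Injective (S i) := by
  classical
  refine ⟨fun h i x y hxy ↦ ?_, fun h f g hfg ↦ ?_⟩
  · have hs : lp.single p i x = lp.single p i y := h <| by
      rw [lp.diagonal_apply_single hB, lp.diagonal_apply_single hB, hxy]
    simpa only [lp.single_apply_self] using congrArg (fun f : lp E p ↦ f i) hs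
  · ext i
    apply h i
    rw [← hB, ← hB, hfg]

/-- For `p < ∞`, a diagonal operator has dense range iff all of its components do. -/
theorem lp.denseRange_diagonal_iff (hp : p ≠ ⊤)
    (hB : ∀ (f : lp E p) (i : ι), (B f : ∀ i, E i) i = S i (f i)) :
    DenseRange B ↔ ∀ i, DenseRange (S i) := by
  classical
  refine ⟨fun h i ↦ ?_, fun h f ↦ ?_⟩
  · have hsurj : Function.Surjective (lp.evalCLM 𝕜 E p i) := fun x ↦
      ⟨lp.single p i x, lp.single_apply_self p i x⟩
    refine (hsurj.denseRange.comp h (lp.evalCLM 𝕜 E p i).continuous).mono ?_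
    rintro _ ⟨f, rfl⟩
    exact ⟨f i, (hB f i).symm⟩
  · let M := B.range.topologicalClosure
    have hsingle (i : ι) (y : E i) : lp.single p i y ∈ M :=
      map_mem_closure (lp.isometry_single i).continuous (h i y) <| by
        rintro _ ⟨x, rfl⟩
        exact ⟨lp.single p i x, lp.diagonal_apply_single hB i x⟩
    exact B.range.isClosed_topologicalClosure.mem_of_tendsto (lp.hasSum_single hp f)
      (.of_forall fun s ↦ M.sum_mem fun i _ ↦ hsingle i (f i))

end DiagonalOperators

/-- `S - τ` is injective iff `τ` is not an eigenvalue of `S`. -/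
theorem ContinuousLinearMap.injective_sub_smul_one_iff {𝕜 E : Type*} [NontriviallyNormedField 𝕜]
    [NormedAddCommGroup E] [NormedSpace 𝕜 E] (S : E →L[𝕜] E) (τ : 𝕜) :
    Function.Injective (S - τ • (1 : E →L[𝕜] E)) ↔ ¬ ∃ x : E, x ≠ 0 ∧ S x = τ • x := by
  rw [injective_iff_map_eq_zero]
  simp only [sub_apply, smul_apply, one_apply_eq_self, sub_eq_zero,
    not_exists, not_and, ne_eq]
  exact forall_congr' fun x ↦ ⟨fun h hx hS ↦ hx (h hS), fun h hS ↦ by_contra fun hx ↦ h hx hS⟩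

/-- Corollary 2.4 (second formula) in the countable direct-sum case:
`τ` belongs to the residual spectrum of the direct sum operator `A = ⊕ₙ Tₙ`
(i.e. `A - τ·id` is injective with non-dense range) if and only if `τ` is not an
eigenvalue of any coordinate operator `T n` and `τ` belongs to the residual spectrum
of some `T n`; i.e. `σ_r(A) = (⋃ₙ σ_p(Aₙ))ᶜ ∩ (⋃ₙ σ_r(Aₙ))`. -/
theorem residual_spectrum_of_direct_sum
    (H : ℕ → Type) [∀ n, NormedAddCommGroup (H n)]
    [∀ n, InnerProductSpace ℂ (H n)] [∀ n, CompleteSpace (H n)]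
    (T : ∀ n, H n →L[ℂ] H n) (hT : ∃ C : ℝ, ∀ n, ‖T n‖ ≤ C)
    (A : lp H 2 →L[ℂ] lp H 2)
    (hA : ∀ f : lp H 2, ∀ n : ℕ, (A f : ∀ n, H n) n = T n (f n))
    (τ : ℂ) :
    (Function.Injective (A - τ • (1 : lp H 2 →L[ℂ] lp H 2)) ∧
        ¬ DenseRange (A - τ • (1 : lp H 2 →L[ℂ] lp H 2))) ↔
      ((∀ n : ℕ, ¬ ∃ x : H n, x ≠ 0 ∧ T n x = τ • x) ∧
        ∃ n : ℕ, Function.Injective (T n - τ • (1 : H n →L[ℂ] H n)) ∧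
          ¬ DenseRange (T n - τ • (1 : H n →L[ℂ] H n))) := by
  have hB (f : lp H 2) (n : ℕ) :
      ((A - τ • (1 : lp H 2 →L[ℂ] lp H 2)) f : ∀ n, H n) n =
        (T n - τ • (1 : H n →L[ℂ] H n)) (f n) :=
    congrArg (· - τ • f n) (hA f n)
  simp only [← ContinuousLinearMap.injective_sub_smul_one_iff]
  rw [lp.injective_diagonal_iff hB, lp.denseRange_diagonal_iff ENNReal.ofNat_ne_top hB, not_forall]
  exact and_congr_right fun h ↦ exists_congr fun n ↦ (and_iff_right (h n)).symm
end

section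
/- Let A be the direct sum operator of the family (T n). Then τ ∈ ℂ belongs to the continuous spectrum of A (i.e. A - τ·id is injective, has dense range, but is not surjective) if and only if either (i) τ is not an eigenvalue of any T n, no T n - τ·id is injective with non-dense range, and there exists n such that T n - τ·id is injective with dense range but not surjective; or (ii) for every n the operator T n - τ·id is boundedly invertible and there is no constant M with ‖(T n - τ·id)⁻¹‖ ≤ M for all n. In other words σ_c(A) = [(⋃_n σ_p(A_n))^c ∩ (⋃_n σ_r(A_n))^c ∩ (⋃_n σ_c(A_n))] ∪ {τ ∈ ⋂_n ρ(A_n) : sup_n ‖R_τ(A_n)‖ = ∞}. (Corollary 2.4, first formula, in the countable direct-sum case.) -/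
section DirectSum

variable {ι 𝕜 : Type*} [NontriviallyNormedField 𝕜] {E : ι → Type*}
  [∀ i, NormedAddCommGroup (E i)] [∀ i, NormedSpace 𝕜 (E i)]
  {p : ENNReal} [Fact (1 ≤ p)] {S : ∀ i, E i →L[𝕜] E i} {B : lp E p →L[𝕜] lp E p}

/-- A direct sum of invertible operators whose inverses are uniformly bounded is surjective. -/
theorem lp.directSum_surjective_of_inverse_bounded (hB : ∀ f i, B f i = S i (f i))
    (hS : ∀ i, IsUnit (S i)) {M : ℝ} (hM : ∀ i, ‖Ring.inverse (S i)‖ ≤ M) :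
    Function.Surjective B := by
  intro f
  have hg : Memℓp (fun i => Ring.inverse (S i) (f i)) p :=
    ((lp.memℓp f).norm.const_mul M).mono fun i =>
      (Ring.inverse (S i)).le_of_opNorm_le (hM i) (f i)
  refine ⟨⟨_, hg⟩, ?_⟩
  ext i
  rw [hB]
  exact DFunLike.congr_fun (Ring.mul_inverse_cancel _ (hS i)) (f i)

variable [DecidableEq ι]

/-- A direct sum operator maps a vector supported in one summand into that summand. -/
theorem lp.directSum_apply_single (hB : ∀ f i, B f i = S i (f i)) (i : ι) (x : E i) :
    B (lp.single p i x) = lp.single p i (S i x) := by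
  ext j
  rw [hB]
  rcases eq_or_ne j i with rfl | hj
  · simp
  · rw [lp.single_apply_ne p i _ hj, lp.single_apply_ne p i _ hj, map_zero]

/-- A direct sum operator is injective iff all its summands are. -/
theorem lp.directSum_injective_iff (hB : ∀ f i, B f i = S i (f i)) :
    Function.Injective B ↔ ∀ i, Function.Injective (S i) := by
  refine ⟨fun h i x y hxy => ?_, fun h f g hfg => ?_⟩
  · have := h (by rw [lp.directSum_apply_single hB, lp.directSum_apply_single hB, hxy] :
      B (lp.single p i x) = B (lp.single p i y))
    exact (lp.isometry_single (E := E) (p := p) i).injective this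
  · ext i
    exact h i (by rw [← hB, ← hB, hfg])

/-- A direct sum operator has dense range iff all its summands do. -/
theorem lp.directSum_denseRange_iff (hp : p ≠ ⊤) (hB : ∀ f i, B f i = S i (f i)) :
    DenseRange B ↔ ∀ i, DenseRange (S i) := by
  refine ⟨fun h i => ?_, fun h => ?_⟩
  · have hsurj : Function.Surjective (lp.evalCLM 𝕜 E p i) := fun x =>
      ⟨lp.single p i x, lp.single_apply_self p i x⟩
    refine (hsurj.denseRange.comp h (lp.evalCLM 𝕜 E p i).continuous).mono ?_
    rintro _ ⟨f, rfl⟩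
    exact ⟨f i, (hB f i).symm⟩
  · have hsingle (i : ι) (x : E i) : lp.single p i x ∈ B.range.topologicalClosure := by
      refine map_mem_closure (lp.isometry_single (E := E) (p := p) i).continuous (h i x) ?_
      rintro _ ⟨y, rfl⟩
      exact ⟨lp.single p i y, lp.directSum_apply_single hB i y⟩
    intro f
    exact B.range.isClosed_topologicalClosure.mem_of_tendsto (lp.hasSum_single hp f)
      (.of_forall fun s => sum_mem fun i _ => hsingle i (f i))

/-- If a direct sum operator is surjective then so are all its summands. -/
theorem lp.directSum_surjective_summand (hB : ∀ f i, B f i = S i (f i))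
    (h : Function.Surjective B) (i : ι) : Function.Surjective (S i) := by
  intro x
  obtain ⟨f, hf⟩ := h (lp.single p i x)
  exact ⟨f i, by rw [← hB, hf, lp.single_apply_self]⟩

/-- The inverses of the summands of an invertible direct sum operator are uniformly bounded. -/
theorem lp.norm_inverse_summand_le (hB : ∀ f i, B f i = S i (f i))
    (hBu : IsUnit B) (hS : ∀ i, IsUnit (S i)) (i : ι) :
    ‖Ring.inverse (S i)‖ ≤ ‖Ring.inverse B‖ := by
  have hp : 0 < p := zero_lt_one.trans_le Fact.out
  refine ContinuousLinearMap.opNorm_le_bound _ (norm_nonneg _) fun x => ?_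
  have hx : Ring.inverse B (lp.single p i x) = lp.single p i (Ring.inverse (S i) x) := by
    have h₁ : S i (Ring.inverse (S i) x) = x :=
      DFunLike.congr_fun (Ring.mul_inverse_cancel _ (hS i)) x
    have h₂ := DFunLike.congr_fun (Ring.inverse_mul_cancel _ hBu)
      (lp.single p i (Ring.inverse (S i) x))
    rw [mul_apply_eq_comp, lp.directSum_apply_single hB, h₁] at h₂
    exact h₂
  calc ‖Ring.inverse (S i) x‖ = ‖Ring.inverse B (lp.single p i x)‖ := by
        rw [hx, lp.norm_single hp]
    _ ≤ ‖Ring.inverse B‖ * ‖lp.single p i x‖ := (Ring.inverse B).le_opNorm _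
    _ = ‖Ring.inverse B‖ * ‖x‖ := by rw [lp.norm_single hp]

end DirectSum


/-- Corollary 2.4 (first formula) in the countable direct-sum case:
`τ` belongs to the continuous spectrum of the direct sum operator `A = ⊕ₙ Tₙ`
(i.e. `A - τ·id` is injective, has dense range, but is not surjective) if and only if
either (i) `τ` is not an eigenvalue of any `T n`, no `T n - τ·id` is injective with
non-dense range, and some `T n - τ·id` is injective with dense range but not surjective,
or (ii) every `T n - τ·id` is boundedly invertible but the inverses are not uniformly
bounded in norm; i.e.
`σ_c(A) = [(⋃ₙ σ_p(Aₙ))ᶜ ∩ (⋃ₙ σ_r(Aₙ))ᶜ ∩ (⋃ₙ σ_c(Aₙ))] ∪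
  {τ ∈ ⋂ₙ ρ(Aₙ) : supₙ ‖R_τ(Aₙ)‖ = ∞}`. -/
theorem continuous_spectrum_of_direct_sum
    (H : ℕ → Type) [∀ n, NormedAddCommGroup (H n)]
    [∀ n, InnerProductSpace ℂ (H n)] [∀ n, CompleteSpace (H n)]
    (T : ∀ n, H n →L[ℂ] H n) (hT : ∃ C : ℝ, ∀ n, ‖T n‖ ≤ C)
    (A : lp H 2 →L[ℂ] lp H 2)
    (hA : ∀ f : lp H 2, ∀ n : ℕ, (A f : ∀ n, H n) n = T n (f n))
    (τ : ℂ) :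
    (Function.Injective (A - τ • (1 : lp H 2 →L[ℂ] lp H 2)) ∧
        DenseRange (A - τ • (1 : lp H 2 →L[ℂ] lp H 2)) ∧
        ¬ Function.Surjective (A - τ • (1 : lp H 2 →L[ℂ] lp H 2))) ↔
      (((∀ n : ℕ, ¬ ∃ x : H n, x ≠ 0 ∧ T n x = τ • x) ∧
          (∀ n : ℕ, ¬ (Function.Injective (T n - τ • (1 : H n →L[ℂ] H n)) ∧
            ¬ DenseRange (T n - τ • (1 : H n →L[ℂ] H n)))) ∧
          (∃ n : ℕ, Function.Injective (T n - τ • (1 : H n →L[ℂ] H n)) ∧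
            DenseRange (T n - τ • (1 : H n →L[ℂ] H n)) ∧
            ¬ Function.Surjective (T n - τ • (1 : H n →L[ℂ] H n)))) ∨
        ((∀ n : ℕ, IsUnit (T n - τ • (1 : H n →L[ℂ] H n))) ∧
          ¬ ∃ M : ℝ, ∀ n : ℕ,
            ‖Ring.inverse (T n - τ • (1 : H n →L[ℂ] H n))‖ ≤ M)) := by
  have hB : ∀ (f : lp H 2) (n : ℕ),
      (A - τ • (1 : lp H 2 →L[ℂ] lp H 2)) f n = (T n - τ • (1 : H n →L[ℂ] H n)) (f n) := by
    intro f n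
    change (A f : ∀ n, H n) n - τ • f n = T n (f n) - τ • f n
    rw [hA]
  have hev (n : ℕ) : (¬ ∃ x : H n, x ≠ 0 ∧ T n x = τ • x) ↔
      Function.Injective (T n - τ • (1 : H n →L[ℂ] H n)) := by
    rw [injective_iff_map_eq_zero]
    simp only [not_exists, not_and', sub_apply, smul_apply, one_apply_eq_self,
      sub_eq_zero, not_not]
  simp only [hev]
  rw [lp.directSum_injective_iff hB, lp.directSum_denseRange_iff ENNReal.ofNat_ne_top hB]
  constructor
  · rintro ⟨hinj, hdense, hsurj⟩
    by_cases hS : ∀ n, Function.Surjective (T n - τ • (1 : H n →L[ℂ] H n))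
    · have hu (n : ℕ) : IsUnit (T n - τ • (1 : H n →L[ℂ] H n)) :=
        ContinuousLinearMap.isUnit_iff_bijective.2 ⟨hinj n, hS n⟩
      exact .inr ⟨hu, fun ⟨_, hM⟩ =>
        hsurj (lp.directSum_surjective_of_inverse_bounded hB hu hM)⟩
    · obtain ⟨n, hn⟩ := not_forall.1 hS
      exact .inl ⟨hinj, fun m h => h.2 (hdense m), n, hinj n, hdense n, hn⟩
  · rintro (⟨hinj, hres, n, -, -, hn⟩ | ⟨hu, hM⟩)
    · exact ⟨hinj, fun m => not_not.1 fun h => hres m ⟨hinj m, h⟩,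
        fun h => hn (lp.directSum_surjective_summand hB h n)⟩
    · have hbij (n : ℕ) := ContinuousLinearMap.isUnit_iff_bijective.1 (hu n)
      refine ⟨fun n => (hbij n).1, fun n => (hbij n).2.denseRange, fun h => hM ?_⟩
      exact ⟨_, lp.norm_inverse_summand_le hB (ContinuousLinearMap.isUnit_iff_bijective.2
        ⟨(lp.directSum_injective_iff hB).2 fun n => (hbij n).1, h⟩) hu⟩
end

section
/- Let A be the direct sum operator of the family (T n), and suppose that every coordinate operator T n is a compact operator on H n. Then A is a compact operator on lp H 2 if and only if lim_{n → ∞} ‖T n‖ = 0. (Theorem 3.3(2).) -/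
open Filter Topology

section HilbertSum

variable {ι : Type*} {H : ι → Type*} [∀ i, NormedAddCommGroup (H i)]
  [∀ i, InnerProductSpace ℂ (H i)]

theorem lp.evalCLM_apply (f : lp H 2) (i : ι) : lp.evalCLM ℂ H 2 i f = f i := rfl

/-- An operator on a Hilbert sum that scales each coordinate by at most `c` has norm at most `c`. -/
theorem lp.opNorm_le_of_forall_norm_apply_le {B : lp H 2 →L[ℂ] lp H 2} {c : ℝ} (hc : 0 ≤ c)
    (hB : ∀ f i, ‖B f i‖ ≤ c * ‖f i‖) : ‖B‖ ≤ c := by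
  refine B.opNorm_le_bound hc fun f => ?_
  have h : ‖B f‖ ≤ ‖(c : ℂ) • f‖ := by
    refine lp.norm_mono (by norm_num) fun i => ?_
    rw [lp.coeFn_smul, Pi.smul_apply, norm_smul, Complex.norm_of_nonneg hc]
    exact hB f i
  rwa [norm_smul, Complex.norm_of_nonneg hc] at h

/-- A direct sum of compact operators whose norms tend to zero is compact. -/
theorem isCompactOperator_directSum_of_tendsto_norm_zero [∀ i, CompleteSpace (H i)]
    {T : ∀ i, H i →L[ℂ] H i} {A : lp H 2 →L[ℂ] lp H 2} (hA : ∀ f i, A f i = T i (f i))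
    (hcomp : ∀ i, IsCompactOperator (T i))
    (hT : Tendsto (fun i => ‖T i‖) cofinite (𝓝 0)) : IsCompactOperator A := by
  classical
  let S (i : ι) : lp H 2 →L[ℂ] lp H 2 :=
    (lp.singleContinuousLinearMap ℂ H 2 i).comp ((T i).comp (lp.evalCLM ℂ H 2 i))
  have hS (s : Finset ι) : IsCompactOperator (∑ i ∈ s, S i : lp H 2 →L[ℂ] lp H 2) :=
    (compactOperator (RingHom.id ℂ) (lp H 2) (lp H 2)).sum_mem fun i _ =>
      ((hcomp i).comp_clm (lp.evalCLM ℂ H 2 i)).clm_comp (lp.singleContinuousLinearMap ℂ H 2 i)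
  refine isCompactOperator_of_tendsto (l := atTop) (F := fun s : Finset ι => ∑ i ∈ s, S i) ?_
    (Eventually.of_forall hS)
  rw [Metric.tendsto_atTop]
  intro ε hε
  have hfin : {i | ¬ ‖T i‖ < ε / 2}.Finite := hT.eventually_lt_const (half_pos hε)
  refine ⟨hfin.toFinset, fun s hs => ?_⟩
  rw [dist_comm, dist_eq_norm]
  refine (lp.opNorm_le_of_forall_norm_apply_le (half_pos hε).le fun f i => ?_).trans_lt
    (half_lt_self hε)
  have hsum : (∑ j ∈ s, S j) f i = if i ∈ s then T i (f i) else 0 := by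
    rw [← lp.evalCLM_apply, sum_apply, map_sum]
    simp [S, lp.evalCLM_apply, Finset.sum_pi_single]
  have hsub : (A - ∑ j ∈ s, S j) f i = A f i - (∑ j ∈ s, S j) f i := rfl
  rw [hsub, hsum, hA]
  split_ifs with hi
  · simpa using by positivity
  · have : ‖T i‖ < ε / 2 := by
      by_contra h
      exact hi (hs (hfin.mem_toFinset.2 h))
    simpa using (T i).le_of_opNorm_le this.le (f i)

/-- If a direct sum of operators is compact, then the norms of the summands tend to zero. -/
theorem tendsto_norm_zero_of_isCompactOperator_directSum
    {T : ∀ i, H i →L[ℂ] H i} {A : lp H 2 →L[ℂ] lp H 2} (hA : ∀ f i, A f i = T i (f i))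
    (hcomp : IsCompactOperator A) : Tendsto (fun i => ‖T i‖) cofinite (𝓝 0) := by
  classical
  have hx (i : ι) : ∃ x : H i, ‖x‖ < 1 ∧ ‖T i‖ ≤ 2 * ‖T i x‖ := by
    rcases (norm_nonneg (T i)).eq_or_lt with h | h
    · exact ⟨0, by simp [← h]⟩
    · obtain ⟨x, hx, hTx⟩ := (T i).exists_lt_apply_of_lt_opNorm (half_lt_self h)
      exact ⟨x, hx, by linarith⟩
  choose x hx1 hx2 using hx
  have hAx (i : ι) : A (lp.single 2 i (x i)) = lp.single 2 i (T i (x i)) := by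
    ext j
    rw [hA]
    rcases eq_or_ne j i with rfl | hj
    · simp
    · simp [hj]
  obtain ⟨K, hK, hsub⟩ :=
    IsCompactOperator.image_ball_subset_compact (f := (A : lp H 2 →ₗ[ℂ] lp H 2)) hcomp 1
  have hlim : Tendsto (fun i => lp.single (E := H) 2 i (T i (x i))) cofinite (𝓝 0) := by
    refine hK.tendsto_nhds_of_unique_mapClusterPt (Eventually.of_forall fun i => ?_)
      fun y _ hy => ?_
    · rw [← hAx]
      exact hsub ⟨_, by simpa [lp.norm_single] using hx1 i, rfl⟩
    · ext j
      have hev := hy.continuousAt_comp (lp.evalCLM ℂ H 2 j).continuous.continuousAt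
      have hz : Tendsto (lp.evalCLM ℂ H 2 j ∘ fun i => lp.single (E := H) 2 i (T i (x i)))
          cofinite (𝓝 0) := by
        refine tendsto_const_nhds.congr' ?_
        filter_upwards [(Set.finite_singleton j).compl_mem_cofinite] with i hi
        have : j ≠ i := fun h => hi h.symm
        simp [lp.evalCLM_apply, this]
      exact eq_of_nhds_neBot (hev.clusterPt.neBot.mono (inf_le_inf_left _ hz))
  have hbound : Tendsto (fun i => 2 * ‖T i (x i)‖) cofinite (𝓝 0) := by
    simpa [lp.norm_single] using hlim.norm.const_mul 2
  exact squeeze_zero (fun i => norm_nonneg _) hx2 hbound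

end HilbertSum

/-- Theorem 3.3(2): if every coordinate operator `T n` is compact, then the direct sum
operator `A = ⊕ₙ Tₙ` is compact on `lp H 2` if and only if `limₙ ‖T n‖ = 0`. -/
theorem compact_direct_sum_iff_norm_tendsto_zero
    (H : ℕ → Type) [∀ n, NormedAddCommGroup (H n)]
    [∀ n, InnerProductSpace ℂ (H n)] [∀ n, CompleteSpace (H n)]
    (T : ∀ n, H n →L[ℂ] H n) (hT : ∃ C : ℝ, ∀ n, ‖T n‖ ≤ C)
    (A : lp H 2 →L[ℂ] lp H 2)
    (hA : ∀ f : lp H 2, ∀ n : ℕ, (A f : ∀ n, H n) n = T n (f n))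
    (hcomp : ∀ n : ℕ, IsCompactOperator (T n)) :
    IsCompactOperator A ↔
      Filter.Tendsto (fun n : ℕ => ‖T n‖) Filter.atTop (nhds 0) := by
  rw [← Nat.cofinite_eq_atTop]
  exact ⟨tendsto_norm_zero_of_isCompactOperator_directSum hA,
    isCompactOperator_directSum_of_tendsto_norm_zero hA hcomp⟩
end

section
/- Let A be the direct sum operator of the family (T n). Then A is polynomially bounded if and only if there exists a single constant M ≥ 1 such that ‖p(T n)‖ ≤ M · ‖p‖_∞ for every n ∈ ℕ and every polynomial p ∈ ℂ[X]; equivalently, A ∈ PB(H) if and only if each A_n ∈ PB(H_n) and sup_n M_p(A_n) < ∞, where M_p denotes the polynomial bound. (Theorem 4.8.) -/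
/-- The sup norm `‖p‖_∞ = sup {|p(z)| : z ∈ ℂ, |z| ≤ 1}` of a complex polynomial
over the closed unit disk. -/
noncomputable def polySupNorm (p : Polynomial ℂ) : ℝ :=
  ⨆ z : Metric.closedBall (0 : ℂ) 1, ‖Polynomial.eval (z : ℂ) p‖

theorem polySupNorm_nonneg (p : Polynomial ℂ) : 0 ≤ polySupNorm p :=
  Real.iSup_nonneg fun _ => norm_nonneg _

section DirectSum

variable {ι : Type*} {E : ι → Type*} [∀ i, NormedAddCommGroup (E i)]
  [∀ i, NormedSpace ℂ (E i)] {q : ENNReal} [Fact (1 ≤ q)]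
  {T : ∀ i, E i →L[ℂ] E i} {A : lp E q →L[ℂ] lp E q}

/-- The polynomial functional calculus of a direct sum operator acts coordinatewise. -/
theorem aeval_directSum_apply
    (hA : ∀ (f : lp E q) (i : ι), (A f : ∀ i, E i) i = T i (f i))
    (p : Polynomial ℂ) (f : lp E q) (i : ι) :
    (Polynomial.aeval A p f : ∀ i, E i) i = Polynomial.aeval (T i) p (f i) := by
  induction p using Polynomial.induction_on' generalizing f with
  | add p r hp hr => simp [hp, hr]
  | monomial n a =>
    have hpow : ∀ g : lp E q, ((A ^ n) g : ∀ i, E i) i = (T i ^ n) (g i) := by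
      induction n with
      | zero => simp
      | succ n ih =>
        intro g
        rw [pow_succ, pow_succ, mul_apply_eq_comp, mul_apply_eq_comp,
          ih, hA]
    simp only [Polynomial.aeval_monomial, Algebra.algebraMap_eq_smul_one, smul_mul_assoc,
      one_mul, smul_apply, lp.coeFn_smul, Pi.smul_apply, hpow]

/-- A coordinate of a direct sum operator has norm at most that of the operator. -/
theorem norm_le_norm_directSum
    (hA : ∀ (f : lp E q) (i : ι), (A f : ∀ i, E i) i = T i (f i)) (i : ι) :
    ‖T i‖ ≤ ‖A‖ := by
  classical
  have hq : 0 < q := zero_lt_one.trans_le Fact.out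
  refine ContinuousLinearMap.opNorm_le_bound _ (norm_nonneg _) fun x => ?_
  calc ‖T i x‖ = ‖(A (lp.single q i x) : ∀ i, E i) i‖ := by rw [hA, lp.single_apply_self]
    _ ≤ ‖A (lp.single q i x)‖ := lp.norm_apply_le_norm hq.ne' _ i
    _ ≤ ‖A‖ * ‖lp.single q i x‖ := A.le_opNorm _
    _ = ‖A‖ * ‖x‖ := by rw [lp.norm_single hq]

/-- A uniform bound on the coordinates bounds the direct sum operator. -/
theorem norm_directSum_le
    (hA : ∀ (f : lp E q) (i : ι), (A f : ∀ i, E i) i = T i (f i))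
    {K : ℝ} (hK : 0 ≤ K) (hT : ∀ i, ‖T i‖ ≤ K) : ‖A‖ ≤ K := by
  have hq : 0 < q := zero_lt_one.trans_le Fact.out
  refine ContinuousLinearMap.opNorm_le_bound _ hK fun f => ?_
  have hKf : ‖(K : ℂ) • f‖ = K * ‖f‖ := by
    rw [norm_smul, Complex.norm_of_nonneg hK]
  rw [← hKf]
  refine lp.norm_mono hq.ne' fun i => ?_
  rw [hA, lp.coeFn_smul, Pi.smul_apply, norm_smul, Complex.norm_of_nonneg hK]
  exact (T i).le_of_opNorm_le (hT i) _

end DirectSum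

/-- Theorem 4.8: the direct sum operator `A = ⊕ₙ Tₙ` is polynomially bounded if and
only if there is a single constant `M ≥ 1` with `‖p(T n)‖ ≤ M·‖p‖_∞` for every `n`
and every polynomial `p` (each `Aₙ ∈ PB(Hₙ)` with `supₙ M_p(Aₙ) < ∞`). -/
theorem polynomially_bounded_direct_sum_iff
    (H : ℕ → Type) [∀ n, NormedAddCommGroup (H n)]
    [∀ n, InnerProductSpace ℂ (H n)] [∀ n, CompleteSpace (H n)]
    (T : ∀ n, H n →L[ℂ] H n) (hT : ∃ C : ℝ, ∀ n, ‖T n‖ ≤ C)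
    (A : lp H 2 →L[ℂ] lp H 2)
    (hA : ∀ f : lp H 2, ∀ n : ℕ, (A f : ∀ n, H n) n = T n (f n)) :
    (∃ M : ℝ, 1 ≤ M ∧
        ∀ p : Polynomial ℂ, ‖Polynomial.aeval A p‖ ≤ M * polySupNorm p) ↔
      (∃ M : ℝ, 1 ≤ M ∧ ∀ n : ℕ,
        ∀ p : Polynomial ℂ, ‖Polynomial.aeval (T n) p‖ ≤ M * polySupNorm p) := by
  constructor
  · rintro ⟨M, hM, h⟩
    exact ⟨M, hM, fun n p =>
      (norm_le_norm_directSum (T := fun n => Polynomial.aeval (T n) p)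
        (aeval_directSum_apply hA p) n).trans (h p)⟩
  · rintro ⟨M, hM, h⟩
    exact ⟨M, hM, fun p => norm_directSum_le (aeval_directSum_apply hA p)
      (mul_nonneg (zero_le_one.trans hM) (polySupNorm_nonneg p)) fun n => h n p⟩
end
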